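/- arXiv:2307.14931 — 5 statements merged into one kernel-verified Lean document; each statement's English description precedes it below -/
import Mathlib

section
/- Let η ≥ 0 and c ≥ 0 be real numbers, let R ≥ 3 be a real number, let S be a finite nonempty set, and let w : S → ℝ satisfy w(x) > 0 for all x ∈ S and ∑_{x ∈ S} w(x) = 1. Assume the entropy bound |∑_{x ∈ S} w(x) · log w(x) + log R| ≤ c · log log R. Then ∑_{x ∈ S} w(x)^η ≥ R^{1−η} · (log R)^{−c·|η−1|}. -/
/-- Jensen's inequality for `exp`: the moments of a probability vector are bounded below by the
exponential of a multiple of its (negative) entropy. -/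
theorem exp_mul_sum_mul_log_le_sum_rpow {α : Type*} (η : ℝ) (S : Finset α) (w : α → ℝ)
    (hw : ∀ x ∈ S, 0 < w x) (hsum : ∑ x ∈ S, w x = 1) :
    Real.exp ((η - 1) * ∑ x ∈ S, w x * Real.log (w x)) ≤ ∑ x ∈ S, w x ^ η := by
  have h := convexOn_exp.map_sum_le (t := S) (w := w)
    (p := fun x => (η - 1) * Real.log (w x)) (fun x hx => (hw x hx).le) hsum
    (fun x _ => Set.mem_univ _)
  simp only [smul_eq_mul] at h
  have hl : ∑ x ∈ S, w x * ((η - 1) * Real.log (w x)) =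
      (η - 1) * ∑ x ∈ S, w x * Real.log (w x) := by
    rw [Finset.mul_sum]
    exact Finset.sum_congr rfl fun x _ => by ring
  have hr : ∑ x ∈ S, w x * Real.exp ((η - 1) * Real.log (w x)) = ∑ x ∈ S, w x ^ η := by
    refine Finset.sum_congr rfl fun x hx => ?_
    rw [mul_comm (η - 1), ← Real.rpow_def_of_pos (hw x hx), Real.rpow_sub_one (hw x hx).ne',
      mul_div_cancel₀ _ (hw x hx).ne']
  rwa [hl, hr] at h


/-- Abstract content of Lemma 2.3: if the probability vector `w` satisfies the
entropy bound `|∑ w(x) log w(x) + log R| ≤ c · log log R`, then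
`∑ w(x)^η ≥ R^(1−η) · (log R)^(−c·|η−1|)`. -/
theorem stmt_2 {α : Type*} (η c : ℝ) (hη : 0 ≤ η) (hc : 0 ≤ c)
    (R : ℝ) (hR : 3 ≤ R) (S : Finset α) (hS : S.Nonempty)
    (w : α → ℝ) (hw : ∀ x ∈ S, 0 < w x) (hsum : ∑ x ∈ S, w x = 1)
    (hent : |∑ x ∈ S, w x * Real.log (w x) + Real.log R| ≤ c * Real.log (Real.log R)) :
    ∑ x ∈ S, w x ^ η ≥ R ^ (1 - η) * Real.log R ^ (-(c * |η - 1|)) := by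
  refine le_trans ?_ (exp_mul_sum_mul_log_le_sum_rpow η S w hw hsum)
  have hRpos : 0 < R := by linarith
  have hlog : 0 < Real.log R := Real.log_pos (by linarith)
  rw [Real.rpow_def_of_pos hRpos, Real.rpow_def_of_pos hlog, ← Real.exp_add, Real.exp_le_exp]
  set H := ∑ x ∈ S, w x * Real.log (w x)
  have hbound : -((η - 1) * (H + Real.log R)) ≤ |η - 1| * (c * Real.log (Real.log R)) :=
    calc -((η - 1) * (H + Real.log R)) ≤ |(η - 1) * (H + Real.log R)| := neg_le_abs _
      _ = |η - 1| * |H + Real.log R| := abs_mul _ _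
      _ ≤ |η - 1| * (c * Real.log (Real.log R)) := by gcongr
  linarith
end

section
/- Let η, β, C₀ be real numbers with 0 ≤ η < 2, β ≥ 0, C₀ ≥ 1, and set C̃ = 1/(1000·C₀). Let R ≥ 2 be an integer and let M = ⌊C̃ · R^{(4−η)/2} · (log R)^{−β}⌋. Then for every integer L with R < L ≤ M, one has binom(M, L) · 3^L · (C₀ · L^{−η/2} · (log R)^{β} · R^{η−1})^L < binom(M, L−1) · 3^{L−1} · (C₀ · (L−1)^{−η/2} · (log R)^{β} · R^{η−1})^{L−1}. -/
/-- Abstract step: `choose M (n+1) / choose M n ≤ M / (n+1)`, so a factor `b` with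
`M * (3 * b) < n + 1` makes the summand decrease. -/
lemma choose_mul_pow_succ_lt {M n : ℕ} (hn : n ≤ M) {a b : ℝ} (hb : 0 < b) (hba : b ≤ a)
    (h : (M : ℝ) * (3 * b) < n + 1) :
    (M.choose (n + 1) : ℝ) * 3 ^ (n + 1) * b ^ (n + 1) < (M.choose n : ℝ) * 3 ^ n * a ^ n := by
  have hchoose : (M.choose (n + 1) : ℝ) * (n + 1) ≤ M.choose n * M := by
    exact_mod_cast (Nat.choose_succ_right_eq M n).le.trans
      (Nat.mul_le_mul_left _ (Nat.sub_le M n))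
  have hpos : (0 : ℝ) < M.choose n := by exact_mod_cast Nat.choose_pos hn
  have hratio : (M.choose (n + 1) : ℝ) * (3 * b) < M.choose n := by
    refine lt_of_mul_lt_mul_right ?_ (by positivity : (0 : ℝ) ≤ n + 1)
    calc (M.choose (n + 1) : ℝ) * (3 * b) * (n + 1)
        = M.choose (n + 1) * (n + 1) * (3 * b) := by ring
      _ ≤ M.choose n * M * (3 * b) := by gcongr
      _ = M.choose n * (M * (3 * b)) := by ring
      _ < M.choose n * (n + 1) := by gcongr
  calc (M.choose (n + 1) : ℝ) * 3 ^ (n + 1) * b ^ (n + 1)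
      = M.choose (n + 1) * (3 * b) * (3 ^ n * b ^ n) := by ring
    _ < M.choose n * (3 ^ n * b ^ n) := by gcongr
    _ ≤ M.choose n * (3 ^ n * a ^ n) := by gcongr
    _ = M.choose n * 3 ^ n * a ^ n := by ring

/-- Monotonicity of summands in the union bound in the proof of Theorem 1.3:
with `C̃ = 1/(1000·C₀)` and `M = ⌊C̃ · R^((4−η)/2) · (log R)^(−β)⌋`, the `L`-th
summand is strictly smaller than the `(L−1)`-st for `R < L ≤ M`. -/
theorem stmt_5 (η β C₀ : ℝ) (hη0 : 0 ≤ η) (hη2 : η < 2) (hβ : 0 ≤ β) (hC₀ : 1 ≤ C₀)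
    (Ct : ℝ) (hCt : Ct = 1 / (1000 * C₀))
    (R : ℕ) (hR : 2 ≤ R)
    (M : ℕ) (hM : M = ⌊Ct * (R : ℝ) ^ ((4 - η) / 2) * Real.log R ^ (-β)⌋₊)
    (L : ℕ) (hL1 : R < L) (hL2 : L ≤ M) :
    (M.choose L : ℝ) * 3 ^ L *
        (C₀ * (L : ℝ) ^ (-(η / 2)) * Real.log R ^ β * (R : ℝ) ^ (η - 1)) ^ L <
      (M.choose (L - 1) : ℝ) * 3 ^ (L - 1) *
        (C₀ * ((L : ℝ) - 1) ^ (-(η / 2)) * Real.log R ^ β * (R : ℝ) ^ (η - 1)) ^ (L - 1) := by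
  obtain ⟨n, rfl⟩ : ∃ n, L = n + 1 := ⟨L - 1, by omega⟩
  have hR0 : (0 : ℝ) < R := by positivity
  have hn0 : (0 : ℝ) < n := by exact_mod_cast (by omega : 0 < n)
  have hRn : (R : ℝ) ≤ n + 1 := by exact_mod_cast hL1.le
  have hlog : 0 < Real.log R := Real.log_pos (by exact_mod_cast hR)
  have hC : 0 < C₀ := by linarith
  rw [Nat.add_sub_cancel]
  push_cast
  rw [add_sub_cancel_right]
  refine choose_mul_pow_succ_lt (by omega) (by positivity) ?_ ?_
  · gcongr ?_ * _ * _
    gcongr C₀ * ?_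
    exact Real.rpow_le_rpow_of_nonpos hn0 (by linarith) (by linarith)
  · have hMle : (M : ℝ) ≤ Ct * (R : ℝ) ^ ((4 - η) / 2) * Real.log R ^ (-β) := by
      rw [hM]
      exact Nat.floor_le (by rw [hCt]; positivity)
    have hlogpow : Real.log R ^ (-β) * Real.log R ^ β = 1 := by
      rw [← Real.rpow_add hlog, neg_add_cancel, Real.rpow_zero]
    have hRpow : (R : ℝ) ^ ((4 - η) / 2) * (R : ℝ) ^ (η - 1) = R * (R : ℝ) ^ (η / 2) := by
      rw [← Real.rpow_add hR0, ← Real.rpow_one_add' hR0.le (by linarith)]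
      congr 1
      ring
    have hLpow : (R : ℝ) ^ (η / 2) * ((n : ℝ) + 1) ^ (-(η / 2)) ≤ 1 := by
      rw [Real.rpow_neg (by positivity), ← div_eq_mul_inv]
      exact div_le_one_of_le₀ (Real.rpow_le_rpow hR0.le hRn (by linarith)) (by positivity)
    have hCtC : Ct * C₀ = 1 / 1000 := by
      rw [hCt]
      field_simp
    calc (M : ℝ) * (3 * (C₀ * ((n : ℝ) + 1) ^ (-(η / 2)) * Real.log R ^ β * (R : ℝ) ^ (η - 1)))
        ≤ Ct * (R : ℝ) ^ ((4 - η) / 2) * Real.log R ^ (-β) *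
          (3 * (C₀ * ((n : ℝ) + 1) ^ (-(η / 2)) * Real.log R ^ β * (R : ℝ) ^ (η - 1))) := by
          gcongr
      _ = 3 * (Ct * C₀) * (Real.log R ^ (-β) * Real.log R ^ β) *
          ((R : ℝ) ^ ((4 - η) / 2) * (R : ℝ) ^ (η - 1)) * ((n : ℝ) + 1) ^ (-(η / 2)) := by ring
      _ = 3 / 1000 * R * ((R : ℝ) ^ (η / 2) * ((n : ℝ) + 1) ^ (-(η / 2))) := by
          rw [hCtC, hlogpow, hRpow]
          ring
      _ ≤ 3 / 1000 * R * 1 := by gcongr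
      _ < n + 1 := by linarith
end

section
/- Let η, β, C₀ be real numbers with 0 ≤ η < 2, β ≥ 0, C₀ ≥ 1, and set C̃ = 1/(1000·C₀). Then for every integer R ≥ 3, with M = ⌊C̃ · R^{(4−η)/2} · (log R)^{−β}⌋, one has M · binom(M, R) · 100·R · 3^R · (C₀ · R^{−η/2} · (log R)^{β} · R^{η−1})^R ≤ (100 · e · C̃ · C₀)^{R+1} · R^{3−η/2}. -/
/-- The binomial coefficient bound `binom(M, R) ≤ (e·x/R)^R` for any real `x ≥ M`. -/
lemma choose_le_exp_mul_div_pow {M R : ℕ} {x : ℝ} (hR : 0 < R) (hx : (M : ℝ) ≤ x) :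
    (M.choose R : ℝ) ≤ (Real.exp 1 * x / R) ^ R := by
  have hR' : (0 : ℝ) < R := by exact_mod_cast hR
  have hfac : (0 : ℝ) < R.factorial := by exact_mod_cast R.factorial_pos
  have hexp : (R : ℝ) ^ R / R.factorial ≤ Real.exp 1 ^ R := by
    rw [← Real.exp_nat_mul, mul_one]
    exact Real.pow_div_factorial_le_exp _ hR'.le _
  calc (M.choose R : ℝ) ≤ (M : ℝ) ^ R / R.factorial := Nat.choose_le_pow_div R M
    _ ≤ x ^ R / R.factorial := by gcongr
    _ = (R : ℝ) ^ R / R.factorial * (x / R) ^ R := by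
        rw [div_pow]; field_simp
    _ ≤ Real.exp 1 ^ R * (x / R) ^ R := by
        have : 0 ≤ x := (Nat.cast_nonneg M).trans hx
        gcongr
    _ = (Real.exp 1 * x / R) ^ R := by rw [← mul_pow, mul_div_assoc]

/-- Explicit estimate in the proof of Theorem 1.3: with `C̃ = 1/(1000·C₀)` and
`M = ⌊C̃ · R^((4−η)/2) · (log R)^(−β)⌋`, the largest summand satisfies
`M · binom(M,R) · 100·R · 3^R · (C₀·R^(−η/2)·(log R)^β·R^(η−1))^R
  ≤ (100·e·C̃·C₀)^(R+1) · R^(3−η/2)`. -/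
theorem stmt_6 (η β C₀ : ℝ) (hη0 : 0 ≤ η) (hη2 : η < 2) (hβ : 0 ≤ β) (hC₀ : 1 ≤ C₀)
    (Ct : ℝ) (hCt : Ct = 1 / (1000 * C₀))
    (R : ℕ) (hR : 3 ≤ R)
    (M : ℕ) (hM : M = ⌊Ct * (R : ℝ) ^ ((4 - η) / 2) * Real.log R ^ (-β)⌋₊) :
    (M : ℝ) * (M.choose R : ℝ) * (100 * R) * 3 ^ R *
        (C₀ * (R : ℝ) ^ (-(η / 2)) * Real.log R ^ β * (R : ℝ) ^ (η - 1)) ^ R ≤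
      (100 * Real.exp 1 * Ct * C₀) ^ (R + 1) * (R : ℝ) ^ (3 - η / 2) := by
  have hR3 : (3 : ℝ) ≤ R := by exact_mod_cast hR
  have hR0 : (0 : ℝ) < R := by linarith
  have hL : 1 ≤ Real.log R := by
    rw [Real.le_log_iff_exp_le hR0]
    linarith [Real.exp_one_lt_d9]
  have hCt0 : 0 < Ct := by rw [hCt]; positivity
  have he : 1 ≤ Real.exp 1 := Real.one_le_exp zero_le_one
  have hP : 1 ≤ Real.log R ^ β := Real.one_le_rpow hL hβ
  have hPinv : Real.log R ^ (-β) = (Real.log R ^ β)⁻¹ := Real.rpow_neg (by linarith) β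
  have hABD : (R : ℝ) ^ ((4 - η) / 2) * (R : ℝ) ^ (-(η / 2)) * (R : ℝ) ^ (η - 1) = R := by
    rw [← Real.rpow_add hR0, ← Real.rpow_add hR0]
    ring_nf
    exact Real.rpow_one _
  have hAR : (R : ℝ) ^ ((4 - η) / 2) * R = (R : ℝ) ^ (3 - η / 2) := by
    rw [← Real.rpow_add_one hR0.ne']
    ring_nf
  have hA : 0 < (R : ℝ) ^ ((4 - η) / 2) := by positivity
  have hB : 0 < (R : ℝ) ^ (-(η / 2)) := by positivity
  have hD : 0 < (R : ℝ) ^ (η - 1) := by positivity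
  rw [← hAR]
  rw [hPinv] at hM
  generalize (R : ℝ) ^ ((4 - η) / 2) = A at *
  generalize (R : ℝ) ^ (-(η / 2)) = B at *
  generalize (R : ℝ) ^ (η - 1) = D at *
  generalize Real.log R ^ β = P at *
  have hP0 : 0 < P := by linarith
  have hMx : (M : ℝ) ≤ Ct * A * P⁻¹ := hM ▸ Nat.floor_le (by positivity)
  have hMA : (M : ℝ) ≤ Ct * A :=
    hMx.trans (mul_le_of_le_one_right (by positivity) (inv_le_one_of_one_le₀ hP))
  have hbase : Real.exp 1 * (Ct * A * P⁻¹) / R * 3 * (C₀ * B * P * D)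
      = 3 * Real.exp 1 * Ct * C₀ := by
    field_simp
    linear_combination hABD
  calc (M : ℝ) * (M.choose R : ℝ) * (100 * R) * 3 ^ R * (C₀ * B * P * D) ^ R
      ≤ Ct * A * (Real.exp 1 * (Ct * A * P⁻¹) / R) ^ R * (100 * R) * 3 ^ R *
          (C₀ * B * P * D) ^ R := by
        gcongr
        exact choose_le_exp_mul_div_pow (by lia) hMx
    _ = Ct * A * (100 * R) * (3 * Real.exp 1 * Ct * C₀) ^ R := by
        rw [← hbase, mul_pow _ (C₀ * B * P * D), mul_pow _ (3 : ℝ)]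
        ring
    _ ≤ Ct * A * (100 * R) * (Real.exp 1 * C₀) * (100 * Real.exp 1 * Ct * C₀) ^ R := by
        refine mul_le_mul (le_mul_of_one_le_right (by positivity)
          (one_le_mul_of_one_le_of_one_le he hC₀)) ?_ (by positivity) (by positivity)
        gcongr
        norm_num
    _ = (100 * Real.exp 1 * Ct * C₀) ^ (R + 1) * (A * R) := by ring
end

section
/- Let η, β, C₀ be real numbers with 0 ≤ η < 2, β ≥ 0, C₀ ≥ 1, and set C̃ = 1/(1000·C₀). Then there exists an integer R₀ such that for every integer R ≥ R₀, with M = ⌊C̃ · R^{(4−η)/2} · (log R)^{−β}⌋, one has ∑_{L=R}^{M} binom(M, L) · 100·R · 3^L · (C₀ · L^{−η/2} · (log R)^{β} · R^{η−1})^L < 2^{−R}. -/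
/-- The standard bound `binom(n, k) ≤ (e n / k) ^ k`. -/
lemma choose_le_exp_one_mul_div_pow (n k : ℕ) (hk : 0 < k) :
    (n.choose k : ℝ) ≤ (Real.exp 1 * n / k) ^ k := by
  have hk' : (0 : ℝ) < k := by exact_mod_cast hk
  have h1 : (n.choose k : ℝ) ≤ (n : ℝ) ^ k / k.factorial := Nat.choose_le_pow_div k n
  have h2 : (k : ℝ) ^ k / k.factorial ≤ Real.exp k :=
    Real.pow_div_factorial_le_exp k hk'.le k
  calc (n.choose k : ℝ) ≤ (n : ℝ) ^ k / k.factorial := h1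
    _ = ((n : ℝ) / k) ^ k * ((k : ℝ) ^ k / k.factorial) := by
        rw [div_pow]
        field_simp
    _ ≤ ((n : ℝ) / k) ^ k * Real.exp k := by gcongr
    _ = (Real.exp 1 * n / k) ^ k := by
        rw [← Real.exp_one_pow, ← mul_pow]
        congr 1
        ring

lemma two_hundred_mul_lt_pow (n : ℕ) (hn : 3 ≤ n) : 200 * n < 25 ^ n := by
  induction n, hn using Nat.le_induction with
  | base => norm_num
  | succ n hn ih =>
    rw [pow_succ]
    omega

/-- The base of the exponential bound for a summand is at most `1 / 100`. -/
lemma summand_base_le (η β C₀ : ℝ) (hη0 : 0 ≤ η) (hC₀ : 1 ≤ C₀) (R L M : ℕ) (hR : 3 ≤ R)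
    (hL : R ≤ L)
    (hM : (M : ℝ) ≤ 1 / (1000 * C₀) * (R : ℝ) ^ ((4 - η) / 2) * Real.log R ^ (-β)) :
    Real.exp 1 * M / L * 3 *
      (C₀ * (L : ℝ) ^ (-(η / 2)) * Real.log R ^ β * (R : ℝ) ^ (η - 1)) ≤ 1 / 100 := by
  have hR0 : (0 : ℝ) < R := by exact_mod_cast (by omega : 0 < R)
  have hRL : (R : ℝ) ≤ L := by exact_mod_cast hL
  have hL0 : (0 : ℝ) < L := hR0.trans_le hRL
  have hlog : 0 < Real.log R := Real.log_pos (by exact_mod_cast (by omega : 1 < R))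
  have hC0 : 0 < C₀ := by linarith
  have hlogβ : Real.log R ^ (-β) * Real.log R ^ β = 1 := by
    rw [← Real.rpow_add hlog, neg_add_cancel, Real.rpow_zero]
  have hpow : (R : ℝ) ^ ((4 - η) / 2) * (R : ℝ) ^ (-(η / 2)) * (R : ℝ) ^ (η - 1) = R := by
    rw [← Real.rpow_add hR0, ← Real.rpow_add hR0]
    ring_nf
    exact Real.rpow_one _
  have hLη : (L : ℝ) ^ (-(η / 2)) ≤ (R : ℝ) ^ (-(η / 2)) :=
    Real.rpow_le_rpow_of_nonpos hR0 hRL (by linarith)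
  calc Real.exp 1 * M / L * 3 *
        (C₀ * (L : ℝ) ^ (-(η / 2)) * Real.log R ^ β * (R : ℝ) ^ (η - 1))
      ≤ Real.exp 1 * (1 / (1000 * C₀) * (R : ℝ) ^ ((4 - η) / 2) * Real.log R ^ (-β)) / R * 3 *
        (C₀ * (R : ℝ) ^ (-(η / 2)) * Real.log R ^ β * (R : ℝ) ^ (η - 1)) := by gcongr
    _ = Real.exp 1 * 3 / 1000 * (C₀ / C₀) * (Real.log R ^ (-β) * Real.log R ^ β) *
        (((R : ℝ) ^ ((4 - η) / 2) * (R : ℝ) ^ (-(η / 2)) * (R : ℝ) ^ (η - 1)) / R) := by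
        field_simp
    _ = Real.exp 1 * 3 / 1000 := by
        rw [hlogβ, hpow, div_self hC0.ne', div_self hR0.ne']
        ring
    _ ≤ 1 / 100 := by linarith [Real.exp_one_lt_d9]


/-- Key quantitative estimate in the proof of Theorem 1.3: with
`C̃ = 1/(1000·C₀)` and `M = ⌊C̃ · R^((4−η)/2) · (log R)^(−β)⌋`, for all large `R`
the union-bound sum `∑_{L=R}^{M} binom(M,L)·100·R·3^L·(C₀·L^(−η/2)·(log R)^β·R^(η−1))^L`
is less than `2^(−R)`. -/
theorem stmt_7 (η β C₀ : ℝ) (hη0 : 0 ≤ η) (hη2 : η < 2) (hβ : 0 ≤ β) (hC₀ : 1 ≤ C₀)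
    (Ct : ℝ) (hCt : Ct = 1 / (1000 * C₀)) :
    ∃ R₀ : ℕ, ∀ R : ℕ, R₀ ≤ R →
      ∀ M : ℕ, M = ⌊Ct * (R : ℝ) ^ ((4 - η) / 2) * Real.log R ^ (-β)⌋₊ →
        ∑ L ∈ Finset.Icc R M,
            (M.choose L : ℝ) * (100 * R) * 3 ^ L *
              (C₀ * (L : ℝ) ^ (-(η / 2)) * Real.log R ^ β * (R : ℝ) ^ (η - 1)) ^ L <
          (2 : ℝ) ^ (-(R : ℝ)) := by
  refine ⟨3, fun R hR M hM => ?_⟩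
  have hlog : 0 < Real.log R := Real.log_pos (by exact_mod_cast (by omega : 1 < R))
  have hM' : (M : ℝ) ≤ 1 / (1000 * C₀) * (R : ℝ) ^ ((4 - η) / 2) * Real.log R ^ (-β) := by
    rw [hM, hCt]
    exact Nat.floor_le (by positivity)
  have hterm : ∀ L ∈ Finset.Icc R M,
      (M.choose L : ℝ) * (100 * R) * 3 ^ L *
        (C₀ * (L : ℝ) ^ (-(η / 2)) * Real.log R ^ β * (R : ℝ) ^ (η - 1)) ^ L ≤
      100 * R * (1 / 50) ^ R * (1 / 2) ^ L := by
    intro L hL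
    have hRL : R ≤ L := (Finset.mem_Icc.mp hL).1
    set b := C₀ * (L : ℝ) ^ (-(η / 2)) * Real.log R ^ β * (R : ℝ) ^ (η - 1)
    have hb : 0 ≤ b := by positivity
    calc (M.choose L : ℝ) * (100 * R) * 3 ^ L * b ^ L
        ≤ (Real.exp 1 * M / L) ^ L * (100 * R) * 3 ^ L * b ^ L := by
          gcongr
          exact choose_le_exp_one_mul_div_pow M L (by omega)
      _ = 100 * R * (Real.exp 1 * M / L * 3 * b) ^ L := by
          rw [mul_pow, mul_pow]
          ring
      _ ≤ 100 * R * (1 / 100) ^ L := by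
          gcongr
          exact summand_base_le η β C₀ hη0 hC₀ R L M hR hRL hM'
      _ = 100 * R * (1 / 50) ^ L * (1 / 2) ^ L := by
          rw [mul_assoc (100 * (R : ℝ)), ← mul_pow]
          norm_num
      _ ≤ 100 * R * (1 / 50) ^ R * (1 / 2) ^ L := by
          gcongr ?_ * ?_ * ?_
          exact pow_le_pow_of_le_one (by norm_num) (by norm_num) hRL
  have hgeom : ∑ L ∈ Finset.Icc R M, (1 / 2 : ℝ) ^ L ≤ 2 :=
    (summable_geometric_two.sum_le_tsum _ fun _ _ => by positivity).trans_eq tsum_geometric_two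
  have hlast : (200 * R : ℝ) < 25 ^ R := by exact_mod_cast two_hundred_mul_lt_pow R hR
  calc _ ≤ ∑ L ∈ Finset.Icc R M, 100 * (R : ℝ) * (1 / 50) ^ R * (1 / 2) ^ L :=
        Finset.sum_le_sum hterm
    _ = 100 * (R : ℝ) * (1 / 50) ^ R * ∑ L ∈ Finset.Icc R M, (1 / 2 : ℝ) ^ L := by
        rw [Finset.mul_sum]
    _ ≤ 100 * (R : ℝ) * (1 / 50) ^ R * 2 := by gcongr
    _ = 200 * R * (1 / 50) ^ R := by ring
    _ < 25 ^ R * (1 / 50) ^ R := by gcongr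
    _ = (2 : ℝ) ^ (-(R : ℝ)) := by
        rw [← mul_pow, Real.rpow_neg (by norm_num), Real.rpow_natCast, ← inv_pow]
        norm_num
end

section
/- Let η, C₀ be real numbers with η ≥ 1, C₀ ≥ 1, and set C̃ = 1/(10000·C₀). Let R ≥ 2 be an integer and let M = ⌊C̃ · R^{(1+η)/η} · (log R)^{−1/2}⌋. Then for every integer L with R < L ≤ M, one has binom(M, L) · 7^L · (C₀ · (log R)^{η/2} · M^{η−1} · R^{−η/2} · L^{−η/2})^L < binom(M, L−1) · 7^{L−1} · (C₀ · (log R)^{η/2} · M^{η−1} · R^{−η/2} · (L−1)^{−η/2})^{L−1}. -/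
/-- If `M u < n + 1` and `u ≤ v`, then the `(n + 1)`-st binomial term at `u` is strictly smaller than
the `n`-th one at `v`. -/
theorem choose_succ_mul_pow_lt {M n : ℕ} (hn : n ≤ M) {u v : ℝ} (hu : 0 < u) (huv : u ≤ v)
    (h : M * u < n + 1) :
    (M.choose (n + 1) : ℝ) * u ^ (n + 1) < M.choose n * v ^ n := by
  have hc : (0 : ℝ) < M.choose n := by exact_mod_cast Nat.choose_pos hn
  have hrec : (M.choose (n + 1) : ℝ) * (n + 1) = M.choose n * (M - n) := by
    have := Nat.choose_succ_right_eq M n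
    rw [← Nat.cast_sub hn]
    exact_mod_cast this
  have hn0 : (0 : ℝ) < n + 1 := by positivity
  have hstep : (M.choose (n + 1) : ℝ) * u < M.choose n := by
    refine lt_of_mul_lt_mul_right ?_ hn0.le
    calc (M.choose (n + 1) : ℝ) * u * (n + 1) = M.choose n * ((M - n) * u) := by
          linear_combination u * hrec
      _ ≤ M.choose n * (M * u) := by gcongr; simp
      _ < M.choose n * (n + 1) := by gcongr
  calc (M.choose (n + 1) : ℝ) * u ^ (n + 1) = M.choose (n + 1) * u * u ^ n := by ring
    _ < M.choose n * u ^ n := by gcongr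
    _ ≤ M.choose n * v ^ n := by gcongr

/-- Upper bound on `m ^ η` when `m` is at most `c r ^ ((1 + η) / η) l ^ (-1 / 2)` with `c ≤ 1`. -/
theorem rpow_le_of_le_mul_rpow {η c r l m : ℝ} (hη : 1 ≤ η) (hc : 0 < c) (hc1 : c ≤ 1)
    (hr : 0 < r) (hl : 0 < l) (hm : 0 ≤ m)
    (h : m ≤ c * r ^ ((1 + η) / η) * l ^ (-(1 / 2 : ℝ))) :
    m ^ η ≤ c * r ^ (1 + η) * l ^ (-(η / 2)) := by
  have hη0 : 0 < η := by linarith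
  calc m ^ η ≤ (c * r ^ ((1 + η) / η) * l ^ (-(1 / 2 : ℝ))) ^ η := by gcongr
    _ = c ^ η * r ^ (1 + η) * l ^ (-(η / 2)) := by
      rw [Real.mul_rpow (by positivity) (by positivity), Real.mul_rpow hc.le (by positivity),
        ← Real.rpow_mul hr.le, ← Real.rpow_mul hl.le]
      congr 2
      · congr 1
        field_simp
      · ring
    _ ≤ c * r ^ (1 + η) * l ^ (-(η / 2)) := by
      gcongr
      simpa using Real.rpow_le_rpow_of_exponent_ge hc hc1 hη


/-- Monotonicity of summands in the union bound in the proof of Theorem 1.4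
(DBM-η on ℤ³, η ≥ 1): with `C̃ = 1/(10000·C₀)` and
`M = ⌊C̃ · R^((1+η)/η) · (log R)^(−1/2)⌋`, the `L`-th summand is strictly smaller
than the `(L−1)`-st for `R < L ≤ M`. -/
theorem stmt_8 (η C₀ : ℝ) (hη : 1 ≤ η) (hC₀ : 1 ≤ C₀)
    (Ct : ℝ) (hCt : Ct = 1 / (10000 * C₀))
    (R : ℕ) (hR : 2 ≤ R)
    (M : ℕ) (hM : M = ⌊Ct * (R : ℝ) ^ ((1 + η) / η) * Real.log R ^ (-(1 / 2 : ℝ))⌋₊)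
    (L : ℕ) (hL1 : R < L) (hL2 : L ≤ M) :
    (M.choose L : ℝ) * 7 ^ L *
        (C₀ * Real.log R ^ (η / 2) * (M : ℝ) ^ (η - 1) * (R : ℝ) ^ (-(η / 2)) *
          (L : ℝ) ^ (-(η / 2))) ^ L <
      (M.choose (L - 1) : ℝ) * 7 ^ (L - 1) *
        (C₀ * Real.log R ^ (η / 2) * (M : ℝ) ^ (η - 1) * (R : ℝ) ^ (-(η / 2)) *
          ((L : ℝ) - 1) ^ (-(η / 2))) ^ (L - 1) := by
  have hη0 : 0 < η := by linarith
  have hR1 : (1 : ℝ) < R := by exact_mod_cast hR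
  have hr : (0 : ℝ) < R := by linarith
  have hl : 0 < Real.log R := Real.log_pos hR1
  have hRL : (R : ℝ) < L := by exact_mod_cast hL1
  have hL0 : (0 : ℝ) < L := by linarith
  have hM0 : (0 : ℝ) < M := by exact_mod_cast (by omega : 0 < M)
  have hC0 : 0 < C₀ := by linarith
  have hCt0 : 0 < Ct := by rw [hCt]; positivity
  have hC : C₀ * Ct = 1 / 10000 := by rw [hCt]; field_simp
  have hCt1 : Ct ≤ 1 := by nlinarith
  have hMη : (M : ℝ) ^ η ≤ Ct * (R : ℝ) ^ (1 + η) * Real.log R ^ (-(η / 2)) := by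
    refine rpow_le_of_le_mul_rpow hη hCt0 hCt1 hr hl hM0.le ?_
    rw [hM]
    exact Nat.floor_le (by positivity)
  have hLR : (L : ℝ) ^ (-(η / 2)) ≤ (R : ℝ) ^ (-(η / 2)) :=
    Real.rpow_le_rpow_of_nonpos hr hRL.le (by linarith)
  have key : M * (7 * (C₀ * Real.log R ^ (η / 2) * (M : ℝ) ^ (η - 1) * (R : ℝ) ^ (-(η / 2)) *
      (L : ℝ) ^ (-(η / 2)))) < L := by
    have hlog : Real.log R ^ (η / 2) * Real.log R ^ (-(η / 2)) = 1 := by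
      rw [← Real.rpow_add hl, add_neg_cancel, Real.rpow_zero]
    have hpow : (R : ℝ) ^ (1 + η) * (R : ℝ) ^ (-(η / 2)) * (R : ℝ) ^ (-(η / 2)) = R := by
      rw [← Real.rpow_add hr, ← Real.rpow_add hr]
      ring_nf
      exact Real.rpow_one _
    have hMM : (M : ℝ) * (M : ℝ) ^ (η - 1) = (M : ℝ) ^ η := by
      rw [Real.rpow_sub_one hM0.ne']
      field_simp
    calc _ = 7 * C₀ * Real.log R ^ (η / 2) * (M : ℝ) ^ η * (R : ℝ) ^ (-(η / 2)) *
          (L : ℝ) ^ (-(η / 2)) := by rw [← hMM]; ring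
      _ ≤ 7 * C₀ * Real.log R ^ (η / 2) * (Ct * (R : ℝ) ^ (1 + η) * Real.log R ^ (-(η / 2))) *
          (R : ℝ) ^ (-(η / 2)) * (R : ℝ) ^ (-(η / 2)) := by gcongr
      _ = 7 * (C₀ * Ct) * (Real.log R ^ (η / 2) * Real.log R ^ (-(η / 2))) *
          ((R : ℝ) ^ (1 + η) * (R : ℝ) ^ (-(η / 2)) * (R : ℝ) ^ (-(η / 2))) := by ring
      _ < L := by rw [hC, hlog, hpow]; linarith
  obtain ⟨n, rfl⟩ : ∃ n, L = n + 1 := ⟨L - 1, by omega⟩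
  have hn0 : (0 : ℝ) < n := by exact_mod_cast (by omega : 0 < n)
  rw [Nat.add_sub_cancel, mul_assoc (M.choose (n + 1) : ℝ), ← mul_pow,
    mul_assoc (M.choose n : ℝ), ← mul_pow]
  refine choose_succ_mul_pow_lt (by omega) (by positivity) ?_ (by exact_mod_cast key)
  push_cast
  rw [add_sub_cancel_right]
  gcongr 7 * (_ * ?_)
  exact Real.rpow_le_rpow_of_nonpos hn0 (by linarith) (by linarith)
end
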